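/- (Continuous-time first integral preservation, Theorem 1.) Let V₁, …, V_K : ℝ^N → ℝ be differentiable functions and let f̂ : ℝ^N → ℝ^N be any map. For each u ∈ ℝ^N let M(u) be the K × N matrix whose k-th row is the gradient ∇V_k(u), assume M(u) M(u)ᵀ is invertible for every u, and define the cFINDE vector field f(u) = (I − Y(u)) f̂(u) with Y(u) = M(u)ᵀ (M(u) M(u)ᵀ)⁻¹ M(u). Then for every differentiable curve u : ℝ → ℝ^N satisfying u'(t) = f(u(t)) for all t, each function t ↦ V_k(u(t)) is constant; that is, every V_k is a first integral of the system du/dt = f(u). -/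

import Mathlib

open Matrix

theorem Matrix.mul_one_sub_transpose_mul_inv_mul {m n R : Type*} [Fintype m] [DecidableEq m]
    [Fintype n] [DecidableEq n] [CommRing R] (A : Matrix m n R) (hA : IsUnit (A * Aᵀ)) :
    A * (1 - Aᵀ * (A * Aᵀ)⁻¹ * A) = 0 := by
  rw [Matrix.mul_sub, Matrix.mul_one, ← Matrix.mul_assoc, ← Matrix.mul_assoc,
    Matrix.mul_nonsing_inv _ ((Matrix.isUnit_iff_isUnit_det _).mp hA), Matrix.one_mul, sub_self]

theorem stmt_1 {K N : ℕ}
    (V : Fin K → EuclideanSpace ℝ (Fin N) → ℝ)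
    (g : Fin K → EuclideanSpace ℝ (Fin N) → EuclideanSpace ℝ (Fin N))
    (hV : ∀ k u, HasGradientAt (V k) (g k u) u)
    (fhat : EuclideanSpace ℝ (Fin N) → EuclideanSpace ℝ (Fin N))
    (M : EuclideanSpace ℝ (Fin N) → Matrix (Fin K) (Fin N) ℝ)
    (hM : ∀ u k i, M u k i = g k u i)
    (hinv : ∀ u, IsUnit (M u * (M u)ᵀ))
    (f : EuclideanSpace ℝ (Fin N) → EuclideanSpace ℝ (Fin N))
    (hf : ∀ u i, f u i =
      (1 - (M u)ᵀ * (M u * (M u)ᵀ)⁻¹ * M u).mulVec (fun j => fhat u j) i)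
    (u : ℝ → EuclideanSpace ℝ (Fin N))
    (hu : ∀ t, HasDerivAt u (f (u t)) t) :
    ∀ k t s, V k (u t) = V k (u s) := by
  intro k t s
  have inner_eq_zero (x : EuclideanSpace ℝ (Fin N)) : inner ℝ (g k x) (f x) = 0 := by
    have h : (M x).mulVec (fun i => f x i) k = 0 := by
      rw [funext (hf x), Matrix.mulVec_mulVec,
        Matrix.mul_one_sub_transpose_mul_inv_mul _ (hinv x), Matrix.zero_mulVec, Pi.zero_apply]
    simpa [Matrix.mulVec, dotProduct, hM, PiLp.inner_apply, mul_comm] using h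
  have hderiv (r : ℝ) : HasDerivAt (V k ∘ u) 0 r := by
    have h := (hV k (u r)).hasFDerivAt.comp_hasDerivAt r (hu r)
    rwa [InnerProductSpace.toDual_apply_apply, inner_eq_zero] at h
  exact is_const_of_deriv_eq_zero (fun r => (hderiv r).differentiableAt)
    (fun r => (hderiv r).deriv) t s
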